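/- Let P be a set of n ≥ e² elements, let k ≥ 1 be an integer, let c > 0, and let c' ≥ 1; set 𝕜 = c'·k. Let Φ be a property of P. Let ⟨p_1, …, p_n⟩ be a uniformly random permutation of P, write P_i = {p_1, …, p_i}, and let X_i be the indicator of the event p_i ∈ Φ(P_i). Suppose that with probability at least 1 − n^{−c}, |Φ(P_i)| ≤ 𝕜 holds simultaneously for all i = 1, …, n. Then for every real γ ≥ 2e, the probability that Σ_{i=1}^n X_i > γ·(2c'k ln n) is at most n^{−γk} + n^{−c}. -/

import Mathlib

open Finset

/-- Splitting off the last entry: the enumerations `Fin (n + 1) → α` of a set `S` of size `n + 1`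
are the extensions by `x ∈ S` of the enumerations of `S.erase x`. -/
lemma image_snoc_eq_iff {α : Type*} [DecidableEq α] {n : ℕ} {S : Finset α} (hS : S.card = n + 1)
    (g : Fin n → α) (x : α) :
    univ.image (Fin.snoc g x : Fin (n + 1) → α) = S ↔ x ∈ S ∧ univ.image g = S.erase x := by
  have himg : univ.image (Fin.snoc g x : Fin (n + 1) → α) = insert x (univ.image g) := by
    ext a
    simp [Fin.exists_fin_succ', or_comm, eq_comm]
  rw [himg]
  constructor
  · rintro rfl
    have hx : x ∉ univ.image g := fun h => by
      rw [insert_eq_of_mem h] at hS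
      have := card_image_le (s := univ) (f := g)
      simp only [card_univ, Fintype.card_fin] at this
      omega
    exact ⟨mem_insert_self _ _, (erase_insert hx).symm⟩
  · rintro ⟨hx, h⟩
    rw [h, insert_erase hx]

lemma image_snoc_Iic_castSucc {α : Type*} [DecidableEq α] {n : ℕ} (g : Fin n → α) (x : α)
    (i : Fin n) :
    (Iic i.castSucc).image (Fin.snoc g x : Fin (n + 1) → α) = (Iic i).image g := by
  ext a
  simp [Fin.exists_fin_succ', Fin.not_le.mpr (Fin.castSucc_lt_last i)]

/-- Backward analysis bound on the (unnormalized) generating function of the number of indices `i`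
with `f i ∈ Φ {f 0, …, f i}`, over all enumerations `f` of `S`. -/
lemma sum_prod_enumeration_le {α : Type*} [Fintype α] [DecidableEq α] (Φ : Finset α → Finset α)
    (hsub : ∀ X, Φ X ⊆ X) {K t : ℝ} (hK : ∀ X, ((Φ X).card : ℝ) ≤ K) (ht : 1 ≤ t) (n : ℕ)
    (S : Finset α) (hS : S.card = n) :
    ∑ f : Fin n → α with univ.image f = S,
        ∏ i, (if f i ∈ Φ ((Iic i).image f) then t else 1)
      ≤ ∏ i ∈ range n, ((i + 1 : ℝ) + (t - 1) * K) := by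
  induction n generalizing S with
  | zero =>
    obtain rfl := card_eq_zero.mp hS
    simp
  | succ n ih =>
    have hstep : ∑ f : Fin (n + 1) → α with univ.image f = S,
          ∏ i, (if f i ∈ Φ ((Iic i).image f) then t else 1)
        = ∑ x ∈ S, (if x ∈ Φ S then t else 1) *
          ∑ g : Fin n → α with univ.image g = S.erase x,
            ∏ i, (if g i ∈ Φ ((Iic i).image g) then t else 1) := by
      rw [sum_filter, ← (Fin.snocEquiv fun _ : Fin (n + 1) => α).sum_comp, Fintype.sum_prod_type,
        ← sum_filter_add_sum_filter_not univ (· ∈ S), filter_mem_eq_inter, univ_inter]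
      rw [add_eq_left.mpr]
      · refine sum_congr rfl fun x hx => ?_
        rw [mul_sum, sum_filter]
        refine sum_congr rfl fun g _ => ?_
        have hiff := image_snoc_eq_iff hS g x
        change (if univ.image (Fin.snoc g x : Fin (n + 1) → α) = S then
          ∏ i, (if (Fin.snoc g x : Fin (n + 1) → α) i ∈
            Φ ((Iic i).image (Fin.snoc g x : Fin (n + 1) → α)) then t else 1) else 0) = _
        by_cases hg : univ.image g = S.erase x
        · have himg := hiff.mpr ⟨hx, hg⟩
          have hlast : Iic (Fin.last n) = univ := by ext j; simp [Fin.le_last]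
          rw [if_pos himg, if_pos hg, Fin.prod_univ_castSucc, mul_comm]
          simp [image_snoc_Iic_castSucc, hlast, himg]
        · rw [if_neg hg, if_neg fun h => hg (hiff.mp h).2]
      · refine sum_eq_zero fun x hx => sum_eq_zero fun g _ => if_neg fun h => ?_
        exact (mem_filter.mp hx).2 ((image_snoc_eq_iff hS g x).mp h).1
    have hweights : ∑ x ∈ S, (if x ∈ Φ S then t else 1) ≤ (n + 1 : ℝ) + (t - 1) * K := by
      have hsum : ∑ x ∈ S, (if x ∈ Φ S then t else 1)
          = ∑ x ∈ S, (1 + if x ∈ Φ S then t - 1 else 0) := by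
        refine sum_congr rfl fun x _ => ?_
        split_ifs <;> ring
      rw [hsum, sum_add_distrib, sum_ite_mem, inter_eq_right.mpr (hsub S)]
      simp only [sum_const, hS, nsmul_eq_mul]
      push_cast
      nlinarith [hK S]
    have hK0 : 0 ≤ K := (Nat.cast_nonneg _).trans (hK ∅)
    rw [hstep, prod_range_succ, mul_comm (∏ i ∈ range n, _)]
    calc _ ≤ ∑ x ∈ S, (if x ∈ Φ S then t else 1) *
          ∏ i ∈ range n, ((i + 1 : ℝ) + (t - 1) * K) := by
          refine sum_le_sum fun x hx => mul_le_mul_of_nonneg_left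
            (ih _ (by rw [card_erase_of_mem hx, hS]; rfl)) ?_
          split_ifs <;> linarith
      _ ≤ _ := by
          rw [← sum_mul]
          refine mul_le_mul_of_nonneg_right hweights (prod_nonneg fun i _ => ?_)
          have := mul_nonneg (sub_nonneg.mpr ht) hK0
          positivity

lemma prod_range_add_le_factorial_mul_exp {a : ℝ} (ha : 0 ≤ a) (n : ℕ) :
    ∏ i ∈ range n, ((i + 1 : ℝ) + a) ≤ n.factorial * Real.exp (a * (1 + Real.log n)) := by
  have hprod : ∏ i ∈ range n, ((i + 1 : ℝ) + a) ≤ n.factorial * Real.exp (a * harmonic n) := by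
    induction n with
    | zero => simp
    | succ n ih =>
      rw [prod_range_succ, harmonic_succ, Nat.factorial_succ]
      push_cast
      have hlast : (n + 1 : ℝ) + a ≤ (n + 1) * Real.exp (a * (n + 1 : ℝ)⁻¹) := by
        have h1 := Real.add_one_le_exp (a * (n + 1 : ℝ)⁻¹)
        have h2 : (n + 1 : ℝ) + a = (n + 1) * (a * (n + 1 : ℝ)⁻¹ + 1) := by
          field_simp
          ring
        rw [h2]
        gcongr
      calc _ ≤ _ := mul_le_mul ih hlast (by positivity) (by positivity)
        _ = _ := by
          rw [mul_add, Real.exp_add]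
          ring
  refine hprod.trans ?_
  gcongr
  exact harmonic_le_one_add_log n

/-- Chernoff-type bound for properties of size at most `K`. -/
lemma card_filter_lt_card_le {α : Type*} [Fintype α] [DecidableEq α] {n : ℕ}
    (hn : Fintype.card α = n) (Φ : Finset α → Finset α) (hsub : ∀ X, Φ X ⊆ X) {K : ℝ}
    (hK : ∀ X, ((Φ X).card : ℝ) ≤ K) (T : ℝ) :
    (#{σ : Fin n ≃ α | T < (#{i : Fin n | σ i ∈ Φ ((Iic i).image σ)} : ℝ)} : ℝ)
      ≤ n.factorial * Real.exp ((Real.exp 1 - 1) * K * (1 + Real.log n) - T) := by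
  have he : 1 ≤ Real.exp 1 := Real.one_le_exp zero_le_one
  have hK0 : 0 ≤ K := (Nat.cast_nonneg _).trans (hK ∅)
  let w : (Fin n → α) → ℝ := fun f =>
    ∏ i, (if f i ∈ Φ ((Iic i).image f) then Real.exp 1 else 1)
  have hw : ∀ f, w f = Real.exp (#{i : Fin n | f i ∈ Φ ((Iic i).image f)}) := fun f => by
    simp [w, prod_ite, ← Real.exp_nat_mul]
  have hsum : ∑ σ : Fin n ≃ α, w σ
      ≤ n.factorial * Real.exp ((Real.exp 1 - 1) * K * (1 + Real.log n)) := by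
    refine le_trans ?_ ((sum_prod_enumeration_le Φ hsub hK he n univ hn).trans
      (prod_range_add_le_factorial_mul_exp (mul_nonneg (sub_nonneg.mpr he) hK0) n))
    rw [← sum_image (f := w) (g := fun σ : Fin n ≃ α => ⇑σ) DFunLike.coe_injective.injOn]
    refine sum_le_sum_of_subset_of_nonneg ?_ fun f _ _ => ?_
    · intro f hf
      obtain ⟨σ, -, rfl⟩ := mem_image.mp hf
      simp [image_univ_of_surjective σ.surjective]
    · exact (hw f).symm ▸ (Real.exp_pos _).le
  rw [Real.exp_sub, mul_div_assoc', le_div_iff₀ (Real.exp_pos T)]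
  refine le_trans ?_ hsum
  rw [← nsmul_eq_mul]
  refine (card_nsmul_le_sum _ _ _ fun σ hσ => ?_).trans
    (sum_le_sum_of_subset_of_nonneg (subset_univ _) fun σ _ _ => ?_)
  · rw [hw]
    exact Real.exp_le_exp.mpr (mem_filter.mp hσ).2.le
  · exact (hw σ).symm ▸ (Real.exp_pos _).le

/-- Backward analysis tail bound (Lemma, part (C)): with `𝕜 = c'·k`, if with
probability at least `1 - n^{-c}` we have `|Φ(P_i)| ≤ 𝕜` simultaneously for all
`i`, then for any `γ ≥ 2e`, the probability that `∑ X_i > γ·(2 c' k ln n)` is at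
most `n^{-γ k} + n^{-c}`.  The uniformly random permutation `⟨p_1, …, p_n⟩` of
`P` is modeled as a uniformly random bijection `σ : Fin n ≃ α`, with `p_i = σ i`
and `P_i = σ({0,…,i})`; here `n ≥ e²`. -/
theorem backward_analysis_tail_prob
    {α : Type*} [Fintype α] [DecidableEq α] (n : ℕ) (hn : Fintype.card α = n)
    (hne : Real.exp 1 ^ 2 ≤ (n : ℝ))
    (k : ℕ) (hk : 1 ≤ k)
    (c c' : ℝ) (hc : 0 < c) (hc' : 1 ≤ c')
    (Φ : Finset α → Finset α)
    (hsub : ∀ X : Finset α, Φ X ⊆ X)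
    (hgood :
      1 - (n : ℝ) ^ (-c) ≤
        ((Finset.univ.filter
            (fun σ : Fin n ≃ α =>
              ∀ i : Fin n,
                ((Φ (Finset.image (⇑σ) (Finset.Iic i))).card : ℝ) ≤ c' * k)).card : ℝ)
          / (Nat.factorial n : ℝ))
    (γ : ℝ) (hγ : 2 * Real.exp 1 ≤ γ) :
    ((Finset.univ.filter
        (fun σ : Fin n ≃ α =>
          γ * (2 * c' * k * Real.log n) <
            ((Finset.univ.filter
                (fun i : Fin n =>
                  σ i ∈ Φ (Finset.image (⇑σ) (Finset.Iic i)))).card : ℝ))).card : ℝ)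
        / (Nat.factorial n : ℝ)
      ≤ (n : ℝ) ^ (-(γ * k)) + (n : ℝ) ^ (-c) := by
  set K : ℝ := c' * k with hKdef
  have hk1 : (1 : ℝ) ≤ k := by exact_mod_cast hk
  have hkK : (k : ℝ) ≤ K := le_mul_of_one_le_left (by positivity) hc'
  have hK0 : 0 ≤ K := by linarith
  have hn0 : (0 : ℝ) < n := (by positivity : (0 : ℝ) < Real.exp 1 ^ 2).trans_le hne
  have hlog : 2 ≤ Real.log n := by
    rw [Real.le_log_iff_exp_le hn0]
    refine le_trans (le_of_eq ?_) hne
    rw [← Real.exp_nat_mul]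
    norm_num
  have hfac : (0 : ℝ) < n.factorial := by positivity
  let Ψ : Finset α → Finset α := fun X => if ((Φ X).card : ℝ) ≤ K then Φ X else ∅
  have hΨsub : ∀ X, Ψ X ⊆ X := fun X => by
    simp only [Ψ]
    split_ifs
    exacts [hsub X, empty_subset X]
  have hΨK : ∀ X, ((Ψ X).card : ℝ) ≤ K := fun X => by
    simp only [Ψ]
    split_ifs with h
    exacts [h, by simpa using hK0]
  set T : ℝ := γ * (2 * c' * k * Real.log n) with hT
  have hchernoff := card_filter_lt_card_le hn Ψ hΨsub hΨK T
  have hexp : Real.exp ((Real.exp 1 - 1) * K * (1 + Real.log n) - T)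
      ≤ (n : ℝ) ^ (-(γ * k)) := by
    rw [Real.rpow_def_of_pos hn0, Real.exp_le_exp]
    have hTK : T = 2 * γ * K * Real.log n := by rw [hT, hKdef]; ring
    have he : 1 ≤ Real.exp 1 := Real.one_le_exp zero_le_one
    have hγ0 : 0 ≤ γ := by linarith
    have h1 : (Real.exp 1 - 1) * K * (1 + Real.log n) ≤ γ / 2 * K * (2 * Real.log n) := by
      gcongr <;> linarith
    have h2 : γ * Real.log n * k ≤ γ * Real.log n * K := by
      gcongr
    rw [hTK]
    linarith
  set G : Finset (Fin n ≃ α) := univ.filter fun σ : Fin n ≃ α =>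
    ∀ i : Fin n, ((Φ (image (⇑σ) (Iic i))).card : ℝ) ≤ K with hG
  have hcardGc : (#Gᶜ : ℝ) ≤ n.factorial * (n : ℝ) ^ (-c) := by
    have hadd : #G + #Gᶜ = n.factorial := by
      rw [card_add_card_compl, Fintype.card_equiv (Fintype.equivFinOfCardEq hn).symm,
        Fintype.card_fin]
    have hadd' : (#G : ℝ) + #Gᶜ = n.factorial := by exact_mod_cast hadd
    rw [le_div_iff₀ hfac] at hgood
    linarith
  rw [div_le_iff₀ hfac]
  have hcover : (univ.filter fun σ : Fin n ≃ α =>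
        T < (#{i : Fin n | σ i ∈ Φ (image (⇑σ) (Iic i))} : ℝ))
      ⊆ (univ.filter fun σ : Fin n ≃ α =>
        T < (#{i : Fin n | σ i ∈ Ψ (image (⇑σ) (Iic i))} : ℝ)) ∪ Gᶜ := by
    intro σ hσ
    by_cases hσG : σ ∈ G
    · have hΨΦ : ∀ i, Ψ (image (⇑σ) (Iic i)) = Φ (image (⇑σ) (Iic i)) := fun i =>
        if_pos ((mem_filter.mp hσG).2 i)
      refine mem_union_left _ ?_
      rw [mem_filter] at hσ ⊢
      simpa only [hΨΦ] using hσ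
    · exact mem_union_right _ (mem_compl.mpr hσG)
  have hcard : ((univ.filter fun σ : Fin n ≃ α =>
        T < (#{i : Fin n | σ i ∈ Φ (image (⇑σ) (Iic i))} : ℝ)).card : ℝ)
      ≤ #{σ : Fin n ≃ α | T < (#{i : Fin n | σ i ∈ Ψ (image (⇑σ) (Iic i))} : ℝ)} + #Gᶜ := by
    exact_mod_cast (card_le_card hcover).trans (card_union_le _ _)
  have := mul_le_mul_of_nonneg_left hexp hfac.le
  linarith
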